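/- arXiv:math/0409275 — 7 statements merged into one kernel-verified Lean document; each statement's English description precedes it below -/
import Mathlib

section
/- The 7-dimensional complex nilpotent Lie algebra 𝔤_G does not admit an ideal I of codimension 1 satisfying [𝔤_G,𝔤_G] ⊆ I and [𝔤_G,[𝔤_G,𝔤_G]] = 0. Here 𝔤_G has basis (x₁,…,x₇) with brackets [x₁,x_i] = x_{i+1} for 2 ≤ i ≤ 6, [x₂,x₃] = x₅, [x₂,x₄] = x₆, [x₂,x₅] = x₇ (all other basis brackets zero). -/
open Module Submodule Filter Topology

/-- The underlying vector space `ℂⁿ`. -/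
abbrev V (n : ℕ) : Type := Fin n → ℂ

/-- A Lie algebra law on `ℂⁿ`: an alternating bilinear map satisfying the Jacobi identity. -/
def IsLieLaw {n : ℕ} (μ : V n → V n → V n) : Prop :=
  (∀ (a : ℂ) (x y z : V n), μ (a • x + y) z = a • μ x z + μ y z) ∧
  (∀ (a : ℂ) (x y z : V n), μ x (a • y + z) = a • μ x y + μ x z) ∧
  (∀ x : V n, μ x x = 0) ∧
  (∀ x y z : V n, μ x (μ y z) + μ y (μ z x) + μ z (μ x y) = 0)

/-- The base-change action of `GL_n(ℂ)` on laws: `(g·μ)(x,y) = g (μ (g⁻¹ x) (g⁻¹ y))`. -/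
noncomputable def act {n : ℕ} (g : V n ≃ₗ[ℂ] V n) (μ : V n → V n → V n) : V n → V n → V n :=
  fun x y => g (μ (g.symm x) (g.symm y))

/-- The `GL_n(ℂ)`-orbit of a law. -/
def lieOrbit {n : ℕ} (μ : V n → V n → V n) : Set (V n → V n → V n) :=
  {ν | ∃ g : V n ≃ₗ[ℂ] V n, ν = act g μ}

/-- `μ` is a degeneration of `λ` if `μ` lies in the closure of the orbit of `λ`. -/
def Degenerates {n : ℕ} (lam mu : V n → V n → V n) : Prop :=
  mu ∈ closure (lieOrbit lam)

/-- The law `𝔤_G` on `ℂ⁷`: `[x₁,x_i] = x_{i+1}` for `2 ≤ i ≤ 6`,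
`[x₂,x₃] = x₅`, `[x₂,x₄] = x₆`, `[x₂,x₅] = x₇`. -/
noncomputable def gGLaw : V 7 → V 7 → V 7 := fun x y =>
  ![0, 0,
    x 0 * y 1 - x 1 * y 0,
    x 0 * y 2 - x 2 * y 0,
    (x 0 * y 3 - x 3 * y 0) + (x 1 * y 2 - x 2 * y 1),
    (x 0 * y 4 - x 4 * y 0) + (x 1 * y 3 - x 3 * y 1),
    (x 0 * y 5 - x 5 * y 0) + (x 1 * y 4 - x 4 * y 1)]

theorem stmt12 :
    ¬ ∃ I : Submodule ℂ (V 7),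
      Module.finrank ℂ I = 6 ∧
      (∀ x : V 7, ∀ y ∈ I, gGLaw x y ∈ I) ∧
      (∀ x y : V 7, gGLaw x y ∈ I) ∧
      (∀ x : V 7, ∀ y ∈ I, ∀ z ∈ I, gGLaw x (gGLaw y z) = 0) := by
  rintro ⟨I, hI, -, hd, h⟩
  -- every element of `I` has vanishing `x₁`- and `x₂`-coordinates
  have key : ∀ y ∈ I, y 0 = 0 ∧ y 1 = 0 := by
    intro y hy
    have h1 := h ![1,0,0,0,0,0,0] y hy _ (hd ![1,0,0,0,0,0,0] ![0,1,0,0,0,0,0])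
    have h4 := congrFun h1 4
    have h5 := congrFun h1 5
    simp [gGLaw] at h4 h5
    exact ⟨h4, h5⟩
  let f : I →ₗ[ℂ] (Fin 5 → ℂ) :=
    (LinearMap.funLeft ℂ ℂ (fun i : Fin 5 => (Fin.natAdd 2 i : Fin 7))).comp I.subtype
  have hf : Function.Injective f := by
    rw [← LinearMap.ker_eq_bot, LinearMap.ker_eq_bot']
    rintro ⟨y, hy⟩ hfy
    obtain ⟨h0, h1⟩ := key y hy
    have hc : ∀ i : Fin 5, y (Fin.natAdd 2 i : Fin 7) = 0 := fun i => congrFun hfy i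
    ext j
    change y j = 0
    fin_cases j
    · exact h0
    · exact h1
    · exact hc 0
    · exact hc 1
    · exact hc 2
    · exact hc 3
    · exact hc 4
  have := LinearMap.finrank_le_finrank_of_injective hf
  rw [hI] at this
  simp at this
end

section
/- The Lie algebra law 𝔤_G on ℂ⁷ is not a degeneration of the law 𝔤_I(1); that is, 𝔤_G does not lie in the closure of the GL_7(ℂ)-orbit of 𝔤_I(1). Here 𝔤_I(1) has brackets [x₁,x_i] = x_{i+1} for 2 ≤ i ≤ 6, [x₂,x₃] = x₅, [x₂,x₄] = x₆, [x₃,x₄] = x₇, and 𝔤_G has brackets [x₁,x_i] = x_{i+1} for 2 ≤ i ≤ 6, [x₂,x₃] = x₅, [x₂,x₄] = x₆, [x₂,x₅] = x₇ (all other basis brackets zero in each case). -/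
open Module Submodule Filter Topology

/-- The law `𝔤_I(1)` on `ℂ⁷`: `[x₁,x_i] = x_{i+1}` for `2 ≤ i ≤ 6`,
`[x₂,x₃] = x₅`, `[x₂,x₄] = x₆`, `[x₃,x₄] = x₇`. -/
noncomputable def gI1Law : V 7 → V 7 → V 7 := fun x y =>
  ![0, 0,
    x 0 * y 1 - x 1 * y 0,
    x 0 * y 2 - x 2 * y 0,
    (x 0 * y 3 - x 3 * y 0) + (x 1 * y 2 - x 2 * y 1),
    (x 0 * y 4 - x 4 * y 0) + (x 1 * y 3 - x 3 * y 1),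
    (x 0 * y 5 - x 5 * y 0) + (x 2 * y 3 - x 3 * y 2)]

/-- Linearization of a map in its second argument. -/
noncomputable def linB (ν : V 7 → V 7 → V 7) (x y : V 7) : V 7 :=
  ∑ j, y j • ν x (Pi.single j 1)

theorem linB_eq (ν : V 7 → V 7 → V 7) (x : V 7) (f : V 7 →ₗ[ℂ] V 7) (h : ∀ y, ν x y = f y)
    (y : V 7) : linB ν x y = ν x y := by
  unfold linB
  rw [h y, LinearMap.pi_apply_eq_sum_univ f y]
  refine Finset.sum_congr rfl fun j _ => ?_
  rw [h]
  congr 2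
  ext k
  simp [Pi.single_apply, eq_comm]

/-- `ad x` for the law `gI1Law`. -/
noncomputable def adI (x : V 7) : V 7 →ₗ[ℂ] V 7 where
  toFun := gI1Law x
  map_add' y z := by
    ext i; fin_cases i <;> simp [gI1Law] <;> ring
  map_smul' a y := by
    ext i; fin_cases i <;> simp [gI1Law] <;> ring

/-- `ad x` for the law `gGLaw`. -/
noncomputable def adG (x : V 7) : V 7 →ₗ[ℂ] V 7 where
  toFun := gGLaw x
  map_add' y z := by
    ext i; fin_cases i <;> simp [gGLaw] <;> ring
  map_smul' a y := by
    ext i; fin_cases i <;> simp [gGLaw] <;> ring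

theorem linB_act (g : V 7 ≃ₗ[ℂ] V 7) (x y : V 7) :
    linB (act g gI1Law) x y = act g gI1Law x y :=
  linB_eq _ x (g.toLinearMap ∘ₗ adI (g.symm x) ∘ₗ g.symm.toLinearMap) (fun _ => rfl) y

theorem linB_G (x y : V 7) : linB gGLaw x y = gGLaw x y :=
  linB_eq _ x (adG x) (fun _ => rfl) y

/-- In `gI1Law`, the action on the fourth term of the lower central series has rank one. -/
theorem gI1_rank_one (x a b c d : V 7) :
    gI1Law x (gI1Law a (gI1Law b (gI1Law c d))) =
      x 0 • ![0, 0, 0, 0, 0, (gI1Law a (gI1Law b (gI1Law c d))) 4,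
        (gI1Law a (gI1Law b (gI1Law c d))) 5] := by
  ext i; fin_cases i <;> simp [gI1Law]

/-- The (linearized) nested bracket `[x₁,[x₁,[x₁,x₂]]]`. -/
noncomputable def wB (ν : V 7 → V 7 → V 7) : V 7 :=
  linB ν (Pi.single 0 1) (linB ν (Pi.single 0 1) (linB ν (Pi.single 0 1) (Pi.single 1 1)))

/-- A polynomial in the structure constants vanishing on the orbit of `gI1Law`. -/
noncomputable def polB (ν : V 7 → V 7 → V 7) : ℂ :=
  linB ν (Pi.single 0 1) (wB ν) 5 * linB ν (Pi.single 1 1) (wB ν) 6 -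
    linB ν (Pi.single 1 1) (wB ν) 5 * linB ν (Pi.single 0 1) (wB ν) 6

theorem continuous_linB (x : V 7) (f : (V 7 → V 7 → V 7) → V 7) (hf : Continuous f) :
    Continuous fun ν => linB ν x (f ν) := by
  unfold linB
  fun_prop

theorem continuous_polB : Continuous polB := by
  have hw : Continuous wB :=
    continuous_linB _ _ (continuous_linB _ _ (continuous_linB _ _ continuous_const))
  have h0 := continuous_linB (Pi.single 0 1) _ hw
  have h1 := continuous_linB (Pi.single 1 1) _ hw
  unfold polB
  exact (((continuous_apply 5).comp h0).mul ((continuous_apply 6).comp h1)).sub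
    (((continuous_apply 5).comp h1).mul ((continuous_apply 6).comp h0))

theorem polB_act (g : V 7 ≃ₗ[ℂ] V 7) : polB (act g gI1Law) = 0 := by
  simp only [polB, wB, linB_act]
  simp only [act, LinearEquiv.symm_apply_apply, gI1_rank_one (g.symm _), map_smul, Pi.smul_apply,
    smul_eq_mul]
  ring

theorem polB_G : polB gGLaw = 1 := by
  simp only [polB, wB, linB_G]
  simp [gGLaw, Pi.single_apply]

theorem stmt13 : ¬ Degenerates gI1Law gGLaw := by
  intro h
  have hc : IsClosed {ν | polB ν = 0} := isClosed_eq continuous_polB continuous_const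
  have hs : lieOrbit gI1Law ⊆ {ν | polB ν = 0} := by
    rintro _ ⟨g, rfl⟩
    exact polB_act g
  have h0 : polB gGLaw = 0 := closure_minimal hs hc h
  rw [polB_G] at h0
  exact one_ne_zero h0
end

section
/- The 7-dimensional nilpotent law 𝔤_F degenerates to 𝔤_E: there exist g_t ∈ GL_7(ℂ) for t ≠ 0 (explicitly, g_t⁻¹ sends x₁ ↦ t x₁, x₂ ↦ t³x₂ + (t⁴/2)x₄, x₃ ↦ t⁴x₃ + (t⁵/2)x₅, x₄ ↦ t⁵x₄ + (t⁶/2)x₆, x₅ ↦ t⁶x₅ + (t⁷/2)x₇, x₆ ↦ t⁷x₆, x₇ ↦ t⁸x₇) such that g_t·𝔤_F converges to a law isomorphic to 𝔤_E as t → 0; in particular 𝔤_E lies in the closure of the GL_7(ℂ)-orbit of 𝔤_F. -/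
open Module Submodule Filter Topology

/-- The law `𝔤_F` on `ℂ⁷`: `[x₁,x_i] = x_{i+1}` for `2 ≤ i ≤ 6`,
`[x₂,x₃] = x₆`, `[x₂,x₄] = x₇`, `[x₂,x₅] = x₇`, `[x₃,x₄] = −x₇`. -/
noncomputable def gFLaw : V 7 → V 7 → V 7 := fun x y =>
  ![0, 0,
    x 0 * y 1 - x 1 * y 0,
    x 0 * y 2 - x 2 * y 0,
    x 0 * y 3 - x 3 * y 0,
    (x 0 * y 4 - x 4 * y 0) + (x 1 * y 2 - x 2 * y 1),
    (x 0 * y 5 - x 5 * y 0) + (x 1 * y 3 - x 3 * y 1)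
      + (x 1 * y 4 - x 4 * y 1) - (x 2 * y 3 - x 3 * y 2)]

/-- The law `𝔤_E` on `ℂ⁷`: `[x₁,x_i] = x_{i+1}` for `2 ≤ i ≤ 6`,
`[x₂,x₃] = x₆ + x₇`, `[x₂,x₄] = x₇`. -/
noncomputable def gELaw : V 7 → V 7 → V 7 := fun x y =>
  ![0, 0,
    x 0 * y 1 - x 1 * y 0,
    x 0 * y 2 - x 2 * y 0,
    x 0 * y 3 - x 3 * y 0,
    (x 0 * y 4 - x 4 * y 0) + (x 1 * y 2 - x 2 * y 1),
    (x 0 * y 5 - x 5 * y 0) + (x 1 * y 2 - x 2 * y 1) + (x 1 * y 3 - x 3 * y 1)]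

/-- The base change `g_t` (for `t ≠ 0`), given with its inverse. -/
noncomputable def gt (t : ℂ) (ht : t ≠ 0) : V 7 ≃ₗ[ℂ] V 7 :=
  LinearEquiv.symm
  { toFun := fun x => ![t * x 0,
            t ^ 3 * x 1,
            t ^ 4 * x 2,
            t ^ 4 / 2 * x 1 + t ^ 5 * x 3,
            t ^ 5 / 2 * x 2 + t ^ 6 * x 4,
            t ^ 6 / 2 * x 3 + t ^ 7 * x 5,
            t ^ 7 / 2 * x 4 + t ^ 8 * x 6]
    invFun := fun y => ![y 0 / t, y 1 / t ^ 3, y 2 / t ^ 4,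
      (y 3 - t / 2 * y 1) / t ^ 5,
      (y 4 - t / 2 * y 2) / t ^ 6,
      (y 5 - t / 2 * (y 3 - t / 2 * y 1)) / t ^ 7,
      (y 6 - t / 2 * (y 4 - t / 2 * y 2)) / t ^ 8]
    map_add' := by
      intro x y; ext i; fin_cases i <;> simp <;> ring
    map_smul' := by
      intro c x; ext i; fin_cases i <;> simp <;> ring
    left_inv := by
      intro x; ext i; fin_cases i <;> simp <;> field_simp <;> ring
    right_inv := by
      intro x; ext i; fin_cases i <;> simp <;> field_simp <;> ring }

/-- The explicit family `g_t · 𝔤_F`, extended to `t = 0`. -/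
noncomputable def fam (t : ℂ) : V 7 → V 7 → V 7 := fun x y =>
  ![0, 0,
    x 0 * y 1 - x 1 * y 0,
    x 0 * y 2 - x 2 * y 0,
    x 0 * y 3 - x 3 * y 0,
    (x 0 * y 4 - x 4 * y 0) + (x 1 * y 2 - x 2 * y 1),
    (x 0 * y 5 - x 5 * y 0) + (x 1 * y 2 - x 2 * y 1) + (x 1 * y 3 - x 3 * y 1)
      + t * ((x 1 * y 4 - x 4 * y 1) - (x 2 * y 3 - x 3 * y 2))]

lemma gt_symm (t : ℂ) (ht : t ≠ 0) (x : V 7) : (gt t ht).symm x =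
          ![t * x 0,
            t ^ 3 * x 1,
            t ^ 4 * x 2,
            t ^ 4 / 2 * x 1 + t ^ 5 * x 3,
            t ^ 5 / 2 * x 2 + t ^ 6 * x 4,
            t ^ 6 / 2 * x 3 + t ^ 7 * x 5,
            t ^ 7 / 2 * x 4 + t ^ 8 * x 6] := rfl

lemma fam_eq (t : ℂ) (ht : t ≠ 0) : fam t = act (gt t ht) gFLaw := by
  funext x y
  unfold act
  rw [← LinearEquiv.symm_apply_eq]
  simp only [gt_symm]
  ext i
  fin_cases i <;> simp [fam, gFLaw] <;> ring

lemma fam_zero : fam 0 = gELaw := by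
  funext x y
  simp [fam, gELaw]

lemma fam_tendsto : Tendsto fam (nhdsWithin (0 : ℂ) {t | t ≠ 0}) (nhds gELaw) := by
  have hc : Continuous fam := by
    refine continuous_pi fun x => continuous_pi fun y => continuous_pi fun i => ?_
    fin_cases i <;> simp [fam] <;> fun_prop
  rw [← fam_zero]
  exact (hc.tendsto 0).mono_left nhdsWithin_le_nhds

theorem stmt14 :
    (∃ f : ℂ → (V 7 → V 7 → V 7),
      (∀ t : ℂ, t ≠ 0 → ∃ g : V 7 ≃ₗ[ℂ] V 7,
        (∀ x : V 7, g.symm x =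
          ![t * x 0,
            t ^ 3 * x 1,
            t ^ 4 * x 2,
            t ^ 4 / 2 * x 1 + t ^ 5 * x 3,
            t ^ 5 / 2 * x 2 + t ^ 6 * x 4,
            t ^ 6 / 2 * x 3 + t ^ 7 * x 5,
            t ^ 7 / 2 * x 4 + t ^ 8 * x 6]) ∧
        f t = act g gFLaw) ∧
      ∃ ν ∈ lieOrbit gELaw, Filter.Tendsto f (nhdsWithin (0 : ℂ) {t | t ≠ 0}) (nhds ν)) ∧
    gELaw ∈ closure (lieOrbit gFLaw) := by
  refine ⟨⟨fam, fun t ht => ⟨gt t ht, gt_symm t ht, fam_eq t ht⟩, gELaw,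
    ⟨LinearEquiv.refl ℂ _, rfl⟩, fam_tendsto⟩, ?_⟩
  have : NeBot (nhdsWithin (0 : ℂ) {t | t ≠ 0}) := inferInstanceAs (NeBot (𝓝[≠] (0 : ℂ)))
  refine mem_closure_of_tendsto fam_tendsto ?_
  filter_upwards [self_mem_nhdsWithin] with t ht
  exact ⟨gt t ht, fam_eq t ht⟩
end

section
/- The 7-dimensional nilpotent law 𝔤_F degenerates to 𝔤_C via the diagonal one-parameter subgroup g_t⁻¹ = diag(t⁻¹, t⁻², t⁻³, t⁻⁴, t⁻⁵, t⁻⁶, t⁻⁷): the laws g_t·𝔤_F converge to a law isomorphic to 𝔤_C as t → 0, so 𝔤_C lies in the closure of the GL_7(ℂ)-orbit of 𝔤_F. -/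
open Module Submodule Filter Topology

/-- The law `𝔤_C` on `ℂ⁷`: `[x₁,x_i] = x_{i+1}` for `2 ≤ i ≤ 6`,
`[x₂,x₅] = x₇`, `[x₃,x₄] = −x₇`. -/
noncomputable def gCLaw : V 7 → V 7 → V 7 := fun x y =>
  ![0, 0,
    x 0 * y 1 - x 1 * y 0,
    x 0 * y 2 - x 2 * y 0,
    x 0 * y 3 - x 3 * y 0,
    x 0 * y 4 - x 4 * y 0,
    (x 0 * y 5 - x 5 * y 0) + (x 1 * y 4 - x 4 * y 1) - (x 2 * y 3 - x 3 * y 2)]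

/-- The diagonal one-parameter subgroup `g_t = diag(t, …, t⁷)`. -/
noncomputable def gDiag (t : ℂ) (ht : t ≠ 0) : V 7 ≃ₗ[ℂ] V 7 where
  toFun x := fun i => t ^ (i.val + 1) * x i
  invFun x := fun i => t⁻¹ ^ (i.val + 1) * x i
  map_add' x y := by ext i; simp [mul_add]
  map_smul' a x := by ext i; simp; ring
  left_inv x := by ext i; simp [ht]
  right_inv x := by ext i; simp [ht]

/-- The explicit family of laws `g_t · 𝔤_F`. -/
noncomputable def famLaw (t : ℂ) : V 7 → V 7 → V 7 := fun x y =>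
  ![0, 0,
    x 0 * y 1 - x 1 * y 0,
    x 0 * y 2 - x 2 * y 0,
    x 0 * y 3 - x 3 * y 0,
    (x 0 * y 4 - x 4 * y 0) + t * (x 1 * y 2 - x 2 * y 1),
    (x 0 * y 5 - x 5 * y 0) + t * (x 1 * y 3 - x 3 * y 1)
      + (x 1 * y 4 - x 4 * y 1) - (x 2 * y 3 - x 3 * y 2)]

lemma gDiag_apply (t : ℂ) (ht : t ≠ 0) (x : V 7) (i : Fin 7) :
    gDiag t ht x i = t ^ (i.val + 1) * x i := rfl

lemma gDiag_symm_apply (t : ℂ) (ht : t ≠ 0) (x : V 7) (i : Fin 7) :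
    (gDiag t ht).symm x i = t⁻¹ ^ (i.val + 1) * x i := rfl

lemma famLaw_eq (t : ℂ) (ht : t ≠ 0) : famLaw t = act (gDiag t ht) gFLaw := by
  funext x y i
  simp only [act, gDiag_apply, gFLaw, gDiag_symm_apply]
  fin_cases i <;> simp [famLaw] <;> field_simp

lemma famLaw_zero : famLaw 0 = gCLaw := by
  funext x y i
  fin_cases i <;> simp [famLaw, gCLaw]

lemma famLaw_continuous : Continuous famLaw := by
  refine continuous_pi fun x => continuous_pi fun y => continuous_pi fun i => ?_
  fin_cases i <;> simp [famLaw] <;> fun_prop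

lemma famLaw_tendsto :
    Filter.Tendsto famLaw (nhdsWithin (0 : ℂ) {t | t ≠ 0}) (nhds gCLaw) := by
  rw [← famLaw_zero]
  exact famLaw_continuous.continuousAt.tendsto.mono_left nhdsWithin_le_nhds

theorem stmt15 :
    (∃ f : ℂ → (V 7 → V 7 → V 7),
      (∀ t : ℂ, t ≠ 0 → ∃ g : V 7 ≃ₗ[ℂ] V 7,
        (∀ x : V 7, g.symm x =
          ![t⁻¹ * x 0, t⁻¹ ^ 2 * x 1, t⁻¹ ^ 3 * x 2, t⁻¹ ^ 4 * x 3,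
            t⁻¹ ^ 5 * x 4, t⁻¹ ^ 6 * x 5, t⁻¹ ^ 7 * x 6]) ∧
        f t = act g gFLaw) ∧
      ∃ ν ∈ lieOrbit gCLaw, Filter.Tendsto f (nhdsWithin (0 : ℂ) {t | t ≠ 0}) (nhds ν)) ∧
    gCLaw ∈ closure (lieOrbit gFLaw) := by
  refine ⟨⟨famLaw, fun t ht => ⟨gDiag t ht, fun x => ?_, famLaw_eq t ht⟩,
    gCLaw, ⟨LinearEquiv.refl ℂ _, rfl⟩, famLaw_tendsto⟩, ?_⟩
  · funext i
    rw [gDiag_symm_apply]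
    fin_cases i <;> simp
  · haveI : (nhdsWithin (0 : ℂ) {t | t ≠ 0}).NeBot :=
      inferInstanceAs (nhdsWithin (0 : ℂ) {0}ᶜ).NeBot
    refine mem_closure_of_tendsto famLaw_tendsto ?_
    filter_upwards [self_mem_nhdsWithin] with t ht
    exact ⟨gDiag t ht, famLaw_eq t ht⟩
end

section
/- The 7-dimensional nilpotent law 𝔤_E degenerates to the standard filiform law 𝔤_A via the diagonal one-parameter subgroup g_t⁻¹ = diag(t, t⁵, t⁶, t⁷, t⁸, t⁹, t¹⁰): the laws g_t·𝔤_E converge to 𝔤_A as t → 0, so 𝔤_A lies in the closure of the GL_7(ℂ)-orbit of 𝔤_E. -/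
open Module Submodule Filter Topology

/-- The standard filiform law `𝔤_A` on `ℂ⁷`: `[x₁,x_i] = x_{i+1}` for `2 ≤ i ≤ 6`. -/
noncomputable def gALaw : V 7 → V 7 → V 7 := fun x y =>
  ![0, 0,
    x 0 * y 1 - x 1 * y 0,
    x 0 * y 2 - x 2 * y 0,
    x 0 * y 3 - x 3 * y 0,
    x 0 * y 4 - x 4 * y 0,
    x 0 * y 5 - x 5 * y 0]

/-- The family `g_t · 𝔤_E`, written out explicitly. -/
noncomputable def famE (t : ℂ) : V 7 → V 7 → V 7 := fun x y =>
  ![0, 0,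
    x 0 * y 1 - x 1 * y 0,
    x 0 * y 2 - x 2 * y 0,
    x 0 * y 3 - x 3 * y 0,
    (x 0 * y 4 - x 4 * y 0) + t ^ 2 * (x 1 * y 2 - x 2 * y 1),
    (x 0 * y 5 - x 5 * y 0) + t * (x 1 * y 2 - x 2 * y 1) + t ^ 2 * (x 1 * y 3 - x 3 * y 1)]

/-- The diagonal map `g_t`, whose inverse is `diag(t, t⁵, …, t¹⁰)`. -/
noncomputable def gT (t : ℂ) (ht : t ≠ 0) : V 7 ≃ₗ[ℂ] V 7 :=
  (LinearEquiv.piCongrRight fun i : Fin 7 =>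
    LinearEquiv.smulOfNeZero ℂ ℂ ((![t, t ^ 5, t ^ 6, t ^ 7, t ^ 8, t ^ 9, t ^ 10] : V 7) i)
      (by fin_cases i <;> simp [ht])).symm

theorem gT_symm (t : ℂ) (ht : t ≠ 0) (x : V 7) : (gT t ht).symm x =
    ![t * x 0, t ^ 5 * x 1, t ^ 6 * x 2, t ^ 7 * x 3,
      t ^ 8 * x 4, t ^ 9 * x 5, t ^ 10 * x 6] := by
  ext i
  fin_cases i <;> rfl

theorem famE_eq (t : ℂ) (ht : t ≠ 0) : famE t = act (gT t ht) gELaw := by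
  funext x y
  unfold act
  rw [← LinearEquiv.symm_apply_eq, gT_symm, gT_symm, gT_symm]
  ext i
  fin_cases i <;> simp [famE, gELaw] <;> ring

theorem famE_tendsto : Tendsto famE (nhdsWithin (0 : ℂ) {t | t ≠ 0}) (nhds gALaw) := by
  have hc : Continuous famE := by
    refine continuous_pi fun x => continuous_pi fun y => continuous_pi fun i => ?_
    fin_cases i <;> simp [famE] <;> fun_prop
  have h0 : famE 0 = gALaw := by
    funext x y
    simp [famE, gALaw]
  rw [← h0]
  exact (hc.tendsto 0).mono_left nhdsWithin_le_nhds

theorem stmt16 :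
    (∃ f : ℂ → (V 7 → V 7 → V 7),
      (∀ t : ℂ, t ≠ 0 → ∃ g : V 7 ≃ₗ[ℂ] V 7,
        (∀ x : V 7, g.symm x =
          ![t * x 0, t ^ 5 * x 1, t ^ 6 * x 2, t ^ 7 * x 3,
            t ^ 8 * x 4, t ^ 9 * x 5, t ^ 10 * x 6]) ∧
        f t = act g gELaw) ∧
      Filter.Tendsto f (nhdsWithin (0 : ℂ) {t | t ≠ 0}) (nhds gALaw)) ∧
    gALaw ∈ closure (lieOrbit gELaw) := by
  refine ⟨⟨famE, fun t ht => ⟨gT t ht, gT_symm t ht, famE_eq t ht⟩, famE_tendsto⟩, ?_⟩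
  haveI : (nhdsWithin (0 : ℂ) {t | t ≠ 0}).NeBot :=
    inferInstanceAs (nhdsWithin (0 : ℂ) {0}ᶜ).NeBot
  refine mem_closure_of_tendsto famE_tendsto ?_
  filter_upwards [self_mem_nhdsWithin] with t ht
  exact ⟨gT t ht, famE_eq t ht⟩
end

section
/- The 7-dimensional nilpotent law 𝔤_C degenerates to 𝔤_{25} via the diagonal one-parameter subgroup g_t⁻¹ = diag(1, t⁻¹, t⁻¹, t⁻¹, t⁻¹, t⁻², t⁻²): the laws g_t·𝔤_C converge to a law isomorphic to 𝔤_{25} as t → 0, so 𝔤_{25} lies in the closure of the GL_7(ℂ)-orbit of 𝔤_C. -/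
open Module Submodule Filter Topology

/-- The law `𝔤₂₅` on `ℂ⁷`: `[x₁,x₂] = x₃`, `[x₁,x₃] = x₄`, `[x₁,x₄] = x₅`,
`[x₁,x₆] = x₇`, `[x₂,x₅] = x₇`, `[x₃,x₄] = −x₇`. -/
noncomputable def g25Law : V 7 → V 7 → V 7 := fun x y =>
  ![0, 0,
    x 0 * y 1 - x 1 * y 0,
    x 0 * y 2 - x 2 * y 0,
    x 0 * y 3 - x 3 * y 0,
    0,
    (x 0 * y 5 - x 5 * y 0) + (x 1 * y 4 - x 4 * y 1) - (x 2 * y 3 - x 3 * y 2)]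

/-- The diagonal transformation `diag(1, t, t, t, t, t², t²)`. -/
noncomputable def diagT (t : ℂ) (ht : t ≠ 0) : V 7 ≃ₗ[ℂ] V 7 where
  toFun x := ![x 0, t * x 1, t * x 2, t * x 3, t * x 4, t ^ 2 * x 5, t ^ 2 * x 6]
  invFun x := ![x 0, t⁻¹ * x 1, t⁻¹ * x 2, t⁻¹ * x 3, t⁻¹ * x 4, t⁻¹ ^ 2 * x 5, t⁻¹ ^ 2 * x 6]
  map_add' x y := by
    ext i; fin_cases i <;> simp <;> ring
  map_smul' a x := by
    ext i; fin_cases i <;> simp <;> ring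
  left_inv x := by
    ext i; fin_cases i <;> simp <;> field_simp
  right_inv x := by
    ext i; fin_cases i <;> simp <;> field_simp

/-- The transported laws, in closed form. -/
noncomputable def famT (t : ℂ) : V 7 → V 7 → V 7 := fun x y =>
  ![0, 0,
    x 0 * y 1 - x 1 * y 0,
    x 0 * y 2 - x 2 * y 0,
    x 0 * y 3 - x 3 * y 0,
    t * (x 0 * y 4 - x 4 * y 0),
    (x 0 * y 5 - x 5 * y 0) + (x 1 * y 4 - x 4 * y 1) - (x 2 * y 3 - x 3 * y 2)]

lemma famT_eq (t : ℂ) (ht : t ≠ 0) : famT t = act (diagT t ht) gCLaw := by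
  funext x y i
  fin_cases i <;> simp [famT, act, diagT, gCLaw] <;> field_simp

lemma famT_zero : famT 0 = g25Law := by
  funext x y i
  fin_cases i <;> simp [famT, g25Law]

lemma famT_cont : Continuous famT := by
  refine continuous_pi fun x => continuous_pi fun y => continuous_pi fun i => ?_
  fin_cases i <;> simp [famT] <;> fun_prop

lemma famT_tendsto :
    Filter.Tendsto famT (nhdsWithin (0 : ℂ) {t | t ≠ 0}) (nhds g25Law) := by
  rw [← famT_zero]
  exact (famT_cont.tendsto 0).mono_left nhdsWithin_le_nhds

theorem stmt17 :
    (∃ f : ℂ → (V 7 → V 7 → V 7),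
      (∀ t : ℂ, t ≠ 0 → ∃ g : V 7 ≃ₗ[ℂ] V 7,
        (∀ x : V 7, g.symm x =
          ![x 0, t⁻¹ * x 1, t⁻¹ * x 2, t⁻¹ * x 3,
            t⁻¹ * x 4, t⁻¹ ^ 2 * x 5, t⁻¹ ^ 2 * x 6]) ∧
        f t = act g gCLaw) ∧
      ∃ ν ∈ lieOrbit g25Law, Filter.Tendsto f (nhdsWithin (0 : ℂ) {t | t ≠ 0}) (nhds ν)) ∧
    g25Law ∈ closure (lieOrbit gCLaw) := by
  refine ⟨⟨famT, fun t ht => ⟨diagT t ht, fun x => rfl, famT_eq t ht⟩, g25Law,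
    ⟨LinearEquiv.refl ℂ (V 7), rfl⟩, famT_tendsto⟩, ?_⟩
  haveI : (nhdsWithin (0 : ℂ) {t | t ≠ 0}).NeBot :=
    inferInstanceAs (nhdsWithin (0 : ℂ) {0}ᶜ).NeBot
  refine mem_closure_of_tendsto famT_tendsto ?_
  filter_upwards [self_mem_nhdsWithin] with t ht
  exact ⟨diagT t ht, famT_eq t ht⟩
end

section
/- In the variety of 4-dimensional complex Lie algebra laws, 𝔰𝔩₂(ℂ) ⊕ ℂ degenerates to 𝔤₅(−1): the law of 𝔤₅(−1) lies in the closure of the GL_4(ℂ)-orbit of the law of 𝔰𝔩₂(ℂ) ⊕ ℂ. -/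
open Module Submodule Filter Topology

/-- The law of `𝔰𝔩₂(ℂ) ⊕ ℂ` on `ℂ⁴`:
`[e₁,e₂] = e₂`, `[e₁,e₃] = −e₃`, `[e₂,e₃] = e₁` (with `e₄` central). -/
noncomputable def sl2CLaw : V 4 → V 4 → V 4 := fun x y =>
  ![x 1 * y 2 - x 2 * y 1,
    x 0 * y 1 - x 1 * y 0,
    -(x 0 * y 2 - x 2 * y 0),
    0]

/-- The law `𝔤₅(−1)` on `ℂ⁴`:
`[e₁,e₂] = e₂`, `[e₁,e₃] = e₂ − e₃`, `[e₂,e₃] = e₄`. -/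
noncomputable def g5m1Law : V 4 → V 4 → V 4 := fun x y =>
  ![0,
    (x 0 * y 1 - x 1 * y 0) + (x 0 * y 2 - x 2 * y 0),
    -(x 0 * y 2 - x 2 * y 0),
    x 1 * y 2 - x 2 * y 1]

/-- The base change for parameter `t`; its inverse sends the basis to
`h + c, t x, t y + (t/2) x, t² h`. -/
noncomputable def gMap (t : ℂ) (ht : t ≠ 0) : V 4 ≃ₗ[ℂ] V 4 where
  toFun v := ![v 3, v 1 / t - v 2 / (2 * t), v 2 / t, (v 0 - v 3) / t ^ 2]
  invFun a := ![a 0 + t ^ 2 * a 3, t * a 1 + t / 2 * a 2, t * a 2, a 0]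
  map_add' v w := by
    ext i; fin_cases i <;> simp <;> ring
  map_smul' c v := by
    ext i; fin_cases i <;> simp <;> ring
  left_inv v := by
    ext i; fin_cases i <;> simp <;> field_simp <;> ring
  right_inv v := by
    ext i; fin_cases i <;> simp <;> field_simp <;> ring

/-- The family of laws, extended polynomially to `t = 0`. -/
noncomputable def lawFamily (t : ℂ) : V 4 → V 4 → V 4 := fun x y =>
  ![0,
    ((x 0 + t ^ 2 * x 3) * y 1 - x 1 * (y 0 + t ^ 2 * y 3))
      + ((x 0 + t ^ 2 * x 3) * y 2 - x 2 * (y 0 + t ^ 2 * y 3)),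
    -((x 0 + t ^ 2 * x 3) * y 2 - x 2 * (y 0 + t ^ 2 * y 3)),
    x 1 * y 2 - x 2 * y 1]

theorem lawFamily_eq_act (t : ℂ) (ht : t ≠ 0) :
    lawFamily t = act (gMap t ht) sl2CLaw := by
  funext x y i
  fin_cases i <;> simp [lawFamily, act, gMap, sl2CLaw] <;> field_simp <;> ring

theorem lawFamily_zero : lawFamily 0 = g5m1Law := by
  funext x y i
  fin_cases i <;> simp [lawFamily, g5m1Law]

theorem continuous_lawFamily : Continuous lawFamily := by
  refine continuous_pi fun x => continuous_pi fun y => continuous_pi fun i => ?_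
  fin_cases i <;> simp [lawFamily] <;> fun_prop

theorem stmt18 : Degenerates sl2CLaw g5m1Law := by
  have h : Tendsto lawFamily (𝓝[≠] 0) (𝓝 g5m1Law) := by
    rw [← lawFamily_zero]
    exact continuous_lawFamily.continuousAt.tendsto.mono_left nhdsWithin_le_nhds
  refine mem_closure_of_tendsto h ?_
  filter_upwards [self_mem_nhdsWithin] with t ht
  exact ⟨gMap t ht, lawFamily_eq_act t ht⟩
end
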